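/- Generalized error–disturbance relationships: suppose the measurement is both retrodictively and predictively unbiased, and moreover [x_f, p_f] = (i ħ) • id, [μXf, p_f] = 0 and [μPf, x_f] = 0. Then the following four inequalities hold: Δei x · Δd p ≥ ħ/2, Δei p · Δd x ≥ ħ/2, Δef x · Δd p ≥ ħ/2, and Δef p · Δd x ≥ ħ/2. -/

import Mathlib

open scoped ComplexInnerProductSpace

noncomputable section

/-- The commutator of two operators. -/
def commOp {E : Type*} [NormedAddCommGroup E] [InnerProductSpace ℂ E]
    (A B : E →ₗ[ℂ] E) : E →ₗ[ℂ] E := A ∘ₗ B - B ∘ₗ A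

/-- The standard deviation of the observable `A` in the state `Ψ`. -/
def stddev {E : Type*} [NormedAddCommGroup E] [InnerProductSpace ℂ E]
    (A : E →ₗ[ℂ] E) (Ψ : E) : ℝ :=
  Real.sqrt (‖A Ψ‖ ^ 2 - (Complex.re ⟪Ψ, A Ψ⟫) ^ 2)

section Auxiliary

variable {E : Type*} [NormedAddCommGroup E] [InnerProductSpace ℂ E]

/-- The inner-product form of the expectation of a commutator. -/
theorem inner_sub_inner_eq_inner_commOp {A B : E →ₗ[ℂ] E} (hA : A.IsSymmetric)
    (hB : B.IsSymmetric) (Ψ : E) :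
    ⟪A Ψ, B Ψ⟫ - ⟪B Ψ, A Ψ⟫ = ⟪Ψ, commOp A B Ψ⟫ := by
  rw [hA Ψ (B Ψ), hB Ψ (A Ψ), ← inner_sub_right]
  rfl

/-- Two operators with the same quadratic form on a complex subspace have the same matrix
elements there. -/
theorem inner_apply_eq_of_quadratic_form_eq {A B : E →ₗ[ℂ] E} {S : Submodule ℂ E}
    (h : ∀ χ ∈ S, ⟪χ, (A - B) χ⟫ = 0) {χ η : E} (hχ : χ ∈ S) (hη : η ∈ S) :
    ⟪χ, A η⟫ = ⟪χ, B η⟫ := by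
  have h' : ∀ ξ ∈ S, ⟪(A - B) ξ, ξ⟫ = 0 := fun ξ hξ => inner_eq_zero_symm.mp (h ξ hξ)
  have key : ⟪(A - B) η, χ⟫ = 0 := by
    rw [inner_map_polarization, h' _ (S.add_mem hχ hη), h' _ (S.sub_mem hχ hη),
      h' _ (S.add_mem hχ (S.smul_mem _ hη)), h' _ (S.sub_mem hχ (S.smul_mem _ hη))]
    simp
  have := inner_eq_zero_symm.mp key
  rwa [LinearMap.sub_apply, inner_sub_right, sub_eq_zero] at this

/-- The commutator expectation of symmetric operators `A` and `B` depends only on the matrix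
elements of `A` on a subspace that `B` preserves. -/
theorem inner_sub_inner_congr {A A' B : E →ₗ[ℂ] E} {S : Submodule ℂ E}
    (hA : A.IsSymmetric) (hA' : A'.IsSymmetric)
    (h : ∀ χ ∈ S, ∀ η ∈ S, ⟪χ, A η⟫ = ⟪χ, A' η⟫) (hB : ∀ χ ∈ S, B χ ∈ S)
    {Ψ : E} (hΨ : Ψ ∈ S) :
    ⟪A Ψ, B Ψ⟫ - ⟪B Ψ, A Ψ⟫ = ⟪A' Ψ, B Ψ⟫ - ⟪B Ψ, A' Ψ⟫ := by
  rw [hA Ψ (B Ψ), hA' Ψ (B Ψ), h _ hΨ _ (hB _ hΨ), h _ (hB _ hΨ) _ hΨ]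

/-- A Robertson-type inequality for differences of vectors. -/
theorem half_norm_le_norm_sub_mul_norm_sub {m a r q : E} {z : ℂ}
    (hmr : ⟪m, r⟫ - ⟪r, m⟫ = 0) (hmq : ⟪m, q⟫ - ⟪q, m⟫ = z)
    (har : ⟪a, r⟫ - ⟪r, a⟫ = z) (haq : ⟪a, q⟫ - ⟪q, a⟫ = z) :
    ‖z‖ / 2 ≤ ‖m - a‖ * ‖r - q‖ := by
  have key : ⟪r - q, m - a⟫ - ⟪m - a, r - q⟫ = z := by
    simp only [inner_sub_left, inner_sub_right]
    linear_combination -hmr + hmq + har - haq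
  have h₁ : ‖⟪r - q, m - a⟫‖ ≤ ‖r - q‖ * ‖m - a‖ := norm_inner_le_norm _ _
  have h₂ : ‖⟪m - a, r - q⟫‖ ≤ ‖m - a‖ * ‖r - q‖ := norm_inner_le_norm _ _
  have h₃ := norm_sub_le ⟪r - q, m - a⟫ ⟪m - a, r - q⟫
  rw [key] at h₃
  linarith [mul_comm ‖r - q‖ ‖m - a‖]

/-- The error–disturbance relation for a pointer `M` which commutes with `R`, where `M`, `A`
and `X` have the same matrix elements on a subspace preserved by `Q`. -/
theorem half_norm_le_error_mul_disturbance {M A X R Q : E →ₗ[ℂ] E} {S : Submodule ℂ E}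
    {Ψ : E} {z : ℂ} (hM : M.IsSymmetric) (hA : A.IsSymmetric) (hX : X.IsSymmetric)
    (hR : R.IsSymmetric)
    (hMX : ∀ χ ∈ S, ∀ η ∈ S, ⟪χ, M η⟫ = ⟪χ, X η⟫)
    (hAX : ∀ χ ∈ S, ∀ η ∈ S, ⟪χ, A η⟫ = ⟪χ, X η⟫)
    (hQS : ∀ χ ∈ S, Q χ ∈ S) (hΨS : Ψ ∈ S)
    (hMR : commOp M R = 0) (hAR : ⟪A Ψ, R Ψ⟫ - ⟪R Ψ, A Ψ⟫ = z)
    (hXQ : ⟪X Ψ, Q Ψ⟫ - ⟪Q Ψ, X Ψ⟫ = z) :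
    ‖z‖ / 2 ≤ ‖(M - A) Ψ‖ * ‖(R - Q) Ψ‖ := by
  refine half_norm_le_norm_sub_mul_norm_sub ?_ ?_ hAR ?_
  · rw [inner_sub_inner_eq_inner_commOp hM hR, hMR, LinearMap.zero_apply, inner_zero_right]
  · rw [inner_sub_inner_congr hM hX hMX hQS hΨS, hXQ]
  · rw [inner_sub_inner_congr hA hX hAX hQS hΨS, hXQ]

end Auxiliary

/-- Generalized error–disturbance relationships for a measurement which is both
retrodictively and predictively unbiased. -/
theorem generalized_error_disturbance_relations
    {E : Type*} [NormedAddCommGroup E] [InnerProductSpace ℂ E]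
    (hbar : ℝ) (hhbar : 0 < hbar)
    (xi pi xf pf muXf muPf : E →ₗ[ℂ] E)
    (hxi : xi.IsSymmetric) (hpi : pi.IsSymmetric)
    (hxf : xf.IsSymmetric) (hpf : pf.IsSymmetric)
    (hmuXf : muXf.IsSymmetric) (hmuPf : muPf.IsSymmetric)
    (hccr : commOp xi pi = (Complex.I * (hbar : ℂ)) • (LinearMap.id : E →ₗ[ℂ] E))
    (S : Submodule ℂ E)
    (hxiS : ∀ χ ∈ S, xi χ ∈ S) (hpiS : ∀ χ ∈ S, pi χ ∈ S)
    (Ψ : E) (hΨS : Ψ ∈ S) (hΨ : ‖Ψ‖ = 1)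
    (hretroX : ∀ χ ∈ S, ⟪χ, (muXf - xi) χ⟫ = 0)
    (hretroP : ∀ χ ∈ S, ⟪χ, (muPf - pi) χ⟫ = 0)
    (hpredX : ∀ χ ∈ S, ⟪χ, (muXf - xf) χ⟫ = 0)
    (hpredP : ∀ χ ∈ S, ⟪χ, (muPf - pf) χ⟫ = 0)
    (hccrf : commOp xf pf = (Complex.I * (hbar : ℂ)) • (LinearMap.id : E →ₗ[ℂ] E))
    (hXfpf : commOp muXf pf = 0) (hPfxf : commOp muPf xf = 0) :
    hbar / 2 ≤ ‖(muXf - xi) Ψ‖ * ‖(pf - pi) Ψ‖ ∧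
    hbar / 2 ≤ ‖(muPf - pi) Ψ‖ * ‖(xf - xi) Ψ‖ ∧
    hbar / 2 ≤ ‖(muXf - xf) Ψ‖ * ‖(pf - pi) Ψ‖ ∧
    hbar / 2 ≤ ‖(muPf - pf) Ψ‖ * ‖(xf - xi) Ψ‖ := by
  have inner_ccr : ∀ {A B : E →ₗ[ℂ] E}, A.IsSymmetric → B.IsSymmetric →
      commOp A B = (Complex.I * (hbar : ℂ)) • (LinearMap.id : E →ₗ[ℂ] E) →
      ⟪A Ψ, B Ψ⟫ - ⟪B Ψ, A Ψ⟫ = Complex.I * hbar := by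
    intro A B hA hB h
    rw [inner_sub_inner_eq_inner_commOp hA hB, h, LinearMap.smul_apply, LinearMap.id_apply,
      inner_smul_right, inner_self_eq_norm_sq_to_K, hΨ]
    simp
  have swap : ∀ {u v : E}, ⟪u, v⟫ - ⟪v, u⟫ = Complex.I * (hbar : ℂ) →
      ⟪v, u⟫ - ⟪u, v⟫ = -(Complex.I * (hbar : ℂ)) := by
    intro u v h
    rw [← h, neg_sub]
  have hz : ‖Complex.I * (hbar : ℂ)‖ = hbar := by simp [abs_of_pos hhbar]
  have hz' : ‖-(Complex.I * (hbar : ℂ))‖ = hbar := by rw [norm_neg, hz]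
  have hi := inner_ccr hxi hpi hccr
  have hf := inner_ccr hxf hpf hccrf
  have hmuX : ∀ χ ∈ S, ∀ η ∈ S, ⟪χ, muXf η⟫ = ⟪χ, xi η⟫ := fun χ hχ η hη =>
    inner_apply_eq_of_quadratic_form_eq hretroX hχ hη
  have hmuP : ∀ χ ∈ S, ∀ η ∈ S, ⟪χ, muPf η⟫ = ⟪χ, pi η⟫ := fun χ hχ η hη =>
    inner_apply_eq_of_quadratic_form_eq hretroP hχ hη
  have hX : ∀ χ ∈ S, ∀ η ∈ S, ⟪χ, xf η⟫ = ⟪χ, xi η⟫ := fun χ hχ η hη =>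
    (inner_apply_eq_of_quadratic_form_eq hpredX hχ hη).symm.trans (hmuX χ hχ η hη)
  have hP : ∀ χ ∈ S, ∀ η ∈ S, ⟪χ, pf η⟫ = ⟪χ, pi η⟫ := fun χ hχ η hη =>
    (inner_apply_eq_of_quadratic_form_eq hpredP hχ hη).symm.trans (hmuP χ hχ η hη)
  have hxipf : ⟪xi Ψ, pf Ψ⟫ - ⟪pf Ψ, xi Ψ⟫ = Complex.I * hbar := by
    have h := inner_sub_inner_congr hpf hpi hP hxiS hΨS
    linear_combination hi - h
  have hxfpi : ⟪xf Ψ, pi Ψ⟫ - ⟪pi Ψ, xf Ψ⟫ = Complex.I * hbar :=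
    (inner_sub_inner_congr hxf hxi hX hpiS hΨS).trans hi
  refine ⟨?_, ?_, ?_, ?_⟩
  · simpa only [hz] using half_norm_le_error_mul_disturbance hmuXf hxi hxi hpf hmuX
      (fun _ _ _ _ => rfl) hpiS hΨS hXfpf hxipf hi
  · simpa only [hz'] using half_norm_le_error_mul_disturbance hmuPf hpi hpi hxf hmuP
      (fun _ _ _ _ => rfl) hxiS hΨS hPfxf (swap hxfpi) (swap hi)
  · simpa only [hz] using half_norm_le_error_mul_disturbance hmuXf hxf hxi hpf hmuX
      hX hpiS hΨS hXfpf hf hi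
  · simpa only [hz'] using half_norm_le_error_mul_disturbance hmuPf hpf hpi hxf hmuP
      hP hxiS hΨS hPfxf (swap hf) (swap hi)

end
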